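/- Let n ≥ 2, d ≥ 3 and let f = a_1 z_1^d + ⋯ + a_n z_n^d with all a_j ∈ ℂ nonzero. Then: (i) f is nondegenerate; (ii) Hess(f) = a_1⋯a_n·(d(d−1))^n·(z_1⋯z_n)^{d−2}; (iii) the associated form of f equals (1/(a_1⋯a_n))·((n(d−2))!/(d!)^n)·e_1^{d−2}⋯e_n^{d−2}; equivalently, μ_{i_1,…,i_n}(f) = 0 for every multi-index with i_1+⋯+i_n = n(d−2) other than (d−2,…,d−2), and μ_{d−2,…,d−2}(f) = 1/(a_1⋯a_n·(d(d−1))^n). -/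

import Mathlib

open MvPolynomial

noncomputable section

/-- The gradient ideal `(f_{z_1},…,f_{z_n})` of a form `f`. -/
def gradIdeal (n : ℕ) (f : MvPolynomial (Fin n) ℂ) : Ideal (MvPolynomial (Fin n) ℂ) :=
  Ideal.span (Set.range fun i => pderiv i f)

/-- The Hessian `det (∂²f/∂z_i∂z_j)` of a form `f`. -/
def hess (n : ℕ) (f : MvPolynomial (Fin n) ℂ) : MvPolynomial (Fin n) ℂ :=
  Matrix.det (Matrix.of fun i j : Fin n => pderiv i (pderiv j f))

/-- `μ` is the system of coefficients defining the associated form of `f`: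
for each multi-index `m` with `|m| = n(d-2)`, the scalar `μ m` satisfies
`z^m - μ m · Hess f ∈ (f_{z_1},…,f_{z_n})`. -/
def IsAssocCoeffs (n d : ℕ) (f : MvPolynomial (Fin n) ℂ) (μ : (Fin n → ℕ) → ℂ) : Prop :=
  ∀ m : Fin n → ℕ, (∑ i, m i) = n * (d - 2) →
    (∏ i, X i ^ m i) - C (μ m) * hess n f ∈ gradIdeal n f

/-- The associated form `Σ_{|m| = n(d-2)} (n(d-2))!/(m_1!⋯m_n!) · μ m · e^m`
built from the coefficients `μ`. -/
def assocForm (n d : ℕ) (μ : (Fin n → ℕ) → ℂ) : MvPolynomial (Fin n) ℂ :=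
  ∑ m ∈ Finset.Nat.antidiagonalTuple n (n * (d - 2)),
    C ((Nat.multinomial Finset.univ m : ℂ) * μ m) * ∏ i, X i ^ m i

end

theorem pderiv_fermat {n : ℕ} (d : ℕ) (a : Fin n → ℂ) (j : Fin n) :
    pderiv j (∑ i, C (a i) * X i ^ d : MvPolynomial (Fin n) ℂ)
      = C (a j * d) * X j ^ (d - 1) := by
  rw [map_sum, Finset.sum_eq_single j]
  · simp only [pderiv_C_mul, pderiv_pow, pderiv_X_self, C_mul, map_natCast, mul_one]
    ring
  · intro i _ hij
    simp [pderiv_X_of_ne hij]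
  · simp

theorem hess_fermat {n d : ℕ} (hd : 1 ≤ d) (a : Fin n → ℂ) :
    hess n (∑ i, C (a i) * X i ^ d)
      = C ((∏ i, a i) * ((d : ℂ) * ((d : ℂ) - 1)) ^ n) * ∏ i, X i ^ (d - 2) := by
  have hdiag : (Matrix.of fun i j : Fin n =>
      pderiv i (pderiv j (∑ i, C (a i) * X i ^ d : MvPolynomial (Fin n) ℂ)))
      = Matrix.diagonal fun i => C (a i * (d * (d - 1))) * X i ^ (d - 2) := by
    ext1 i j
    rw [Matrix.of_apply, pderiv_fermat, pderiv_C_mul, pderiv_pow]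
    rcases eq_or_ne i j with rfl | hij
    · rw [Matrix.diagonal_apply_eq, pderiv_X_self, Nat.sub_sub]
      simp only [C_mul, C_sub, map_natCast, Nat.cast_sub hd, C_1, Nat.cast_one]
      ring
    · rw [Matrix.diagonal_apply_ne _ hij, pderiv_X_of_ne hij.symm]
      simp
  rw [hess, hdiag, Matrix.det_diagonal, Finset.prod_mul_distrib, ← map_prod,
    Finset.prod_mul_distrib]
  simp

theorem prod_X_pow_eq_monomial_equivFunOnFinite {n : ℕ} (m : Fin n → ℕ) :
    (∏ i, X i ^ m i : MvPolynomial (Fin n) ℂ)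
      = monomial (Finsupp.equivFunOnFinite.symm m) 1 := by
  rw [monomial_eq, C_1, one_mul, Finsupp.prod_fintype _ _ (by simp)]
  simp

/-- The socle monomial does not occur in elements of the gradient ideal of a Fermat-type form. -/
theorem coeff_eq_zero_of_mem_gradIdeal_fermat {n d : ℕ} (hd : 2 ≤ d) (a : Fin n → ℂ)
    {p : MvPolynomial (Fin n) ℂ} (hp : p ∈ gradIdeal n (∑ i, C (a i) * X i ^ d)) :
    coeff (Finsupp.equivFunOnFinite.symm fun _ => d - 2) p = 0 := by
  obtain ⟨c, rfl⟩ := Ideal.mem_span_range_iff_exists_fun.mp hp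
  rw [coeff_sum]
  refine Finset.sum_eq_zero fun i _ => ?_
  rw [pderiv_fermat, C_mul_X_pow_eq_monomial, coeff_mul_monomial', if_neg]
  intro h
  have := h i
  simp at this
  omega

theorem multinomial_const (n k : ℕ) :
    (Nat.multinomial Finset.univ (fun _ : Fin n => k) : ℂ)
      = ((n * k).factorial : ℂ) / (k.factorial : ℂ) ^ n := by
  have h := Nat.multinomial_spec Finset.univ (fun _ : Fin n => k)
  simp only [Finset.prod_const, Finset.sum_const, Finset.card_univ, Fintype.card_fin,
    smul_eq_mul] at h
  rw [eq_div_iff (pow_ne_zero _ (Nat.cast_ne_zero.mpr k.factorial_ne_zero)), mul_comm, ← h]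
  push_cast
  rfl

theorem IsAssocCoeffs.fermat_apply {n d : ℕ} (hd : 2 ≤ d) {a : Fin n → ℂ} (ha : ∀ i, a i ≠ 0)
    {μ : (Fin n → ℕ) → ℂ} (hμ : IsAssocCoeffs n d (∑ i, C (a i) * X i ^ d) μ)
    {m : Fin n → ℕ} (hm : ∑ i, m i = n * (d - 2)) :
    μ m = if m = (fun _ => d - 2) then 1 / ((∏ i, a i) * ((d : ℂ) * ((d : ℂ) - 1)) ^ n)
      else 0 := by
  have hc : (∏ i, a i) * ((d : ℂ) * ((d : ℂ) - 1)) ^ n ≠ 0 := by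
    have hd1 : (d : ℂ) - 1 ≠ 0 := sub_ne_zero.mpr (by exact_mod_cast (by omega : d ≠ 1))
    have hd0 : (d : ℂ) ≠ 0 := by exact_mod_cast (by omega : d ≠ 0)
    exact mul_ne_zero (Finset.prod_ne_zero_iff.mpr fun i _ => ha i)
      (pow_ne_zero _ (mul_ne_zero hd0 hd1))
  have h := coeff_eq_zero_of_mem_gradIdeal_fermat hd a (hμ m hm)
  rw [hess_fermat (by omega), prod_X_pow_eq_monomial_equivFunOnFinite,
    prod_X_pow_eq_monomial_equivFunOnFinite (fun _ => d - 2), coeff_sub, coeff_C_mul, coeff_C_mul,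
    coeff_monomial, coeff_monomial, if_pos rfl, mul_one, sub_eq_zero] at h
  simp only [EmbeddingLike.apply_eq_iff_eq] at h
  split_ifs at h ⊢ with hms
  · rw [eq_div_iff hc, ← h]
  · exact (mul_eq_zero.mp h.symm).resolve_right hc

/-- For `f = a_1 z_1^d + ⋯ + a_n z_n^d` with all `a_i ≠ 0`:
(i) `f` is nondegenerate; (ii) `Hess f = a_1⋯a_n (d(d-1))^n (z_1⋯z_n)^{d-2}`;
(iii) the associated form of `f` is `(1/(a_1⋯a_n))·((n(d-2))!/(d!)^n)·e_1^{d-2}⋯e_n^{d-2}`,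
equivalently `μ_m(f) = 0` for `m ≠ (d-2,…,d-2)` and
`μ_{(d-2,…,d-2)}(f) = 1/(a_1⋯a_n (d(d-1))^n)`. -/
theorem assocForm_of_fermat_type
    (n d : ℕ) (hn : 2 ≤ n) (hd : 3 ≤ d) (a : Fin n → ℂ) (ha : ∀ i, a i ≠ 0) :
    letI f : MvPolynomial (Fin n) ℂ := ∑ i, C (a i) * X i ^ d
    (∀ p : Fin n → ℂ, (∀ i, eval p (pderiv i f) = 0) → p = 0)
      ∧ hess n f = C ((∏ i, a i) * ((d : ℂ) * ((d : ℂ) - 1)) ^ n) * ∏ i, X i ^ (d - 2)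
      ∧ ∀ μ : (Fin n → ℕ) → ℂ, IsAssocCoeffs n d f μ →
          ((∀ m : Fin n → ℕ, (∑ i, m i) = n * (d - 2) → m ≠ (fun _ => d - 2) → μ m = 0)
            ∧ μ (fun _ => d - 2) = 1 / ((∏ i, a i) * ((d : ℂ) * ((d : ℂ) - 1)) ^ n)
            ∧ assocForm n d μ
                = C ((1 / ∏ i, a i) * ((n * (d - 2)).factorial : ℂ) / (d.factorial : ℂ) ^ n)
                    * ∏ i, X i ^ (d - 2)) := by
  have hsum : ∑ _i : Fin n, (d - 2) = n * (d - 2) := by simp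
  refine ⟨fun p hp => ?_, hess_fermat (by omega) a, fun μ hμ => ⟨fun m hm hne => ?_, ?_, ?_⟩⟩
  · funext i
    have h := hp i
    rw [pderiv_fermat, eval_mul, eval_C, eval_pow, eval_X] at h
    have hd0 : (d : ℂ) ≠ 0 := by exact_mod_cast (by omega : d ≠ 0)
    exact eq_zero_of_pow_eq_zero ((mul_eq_zero.mp h).resolve_left (mul_ne_zero (ha i) hd0))
  · rw [hμ.fermat_apply (by omega) ha hm, if_neg hne]
  · rw [hμ.fermat_apply (by omega) ha hsum, if_pos rfl]
  · rw [assocForm, Finset.sum_eq_single fun _ => d - 2]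
    · rw [hμ.fermat_apply (by omega) ha hsum, if_pos rfl, multinomial_const]
      congr 2
      obtain ⟨k, rfl⟩ : ∃ k, d = k + 2 := ⟨d - 2, by omega⟩
      have hfac : ((k + 2).factorial : ℂ)
          = ((k + 2 : ℕ) : ℂ) * (((k + 2 : ℕ) : ℂ) - 1) * k.factorial := by
        rw [Nat.factorial_succ, Nat.factorial_succ]
        push_cast
        ring
      rw [hfac, mul_pow _ (k.factorial : ℂ), Nat.add_sub_cancel, div_mul_div_comm, mul_one,
        one_div_mul_eq_div, div_div]
      congr 1
      ring
    · intro m hm hne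
      rw [hμ.fermat_apply (by omega) ha (Finset.Nat.mem_antidiagonalTuple.mp hm), if_neg hne]
      simp
    · exact fun h => absurd (Finset.Nat.mem_antidiagonalTuple.mpr hsum) h
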